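/- The set B = {δ, −(φ₁+φ₂+2φ₃+2φ₄), φ₃, φ₄} is a base of Δ, and the positive system determined by B equals Δ_k⁺ ∪ {β ∈ Δ_n⁺ : β ≥ φ₁+2φ₂+2φ₃} ∪ (−{β ∈ Δ_n⁺ : β ≤ φ₁+φ₂+2φ₃+2φ₄}); in particular this positive system contains Δ_k⁺. -/

import Mathlib

noncomputable section

abbrev V : Type := Fin 4 → ℝ

def e (i : Fin 4) : V := Pi.single i 1

/-- The root system of type F₄ in ℝ⁴ (48 vectors). -/
def Δ : Set V :=
  (⋃ i, ({e i, -e i} : Set V)) ∪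
  (⋃ (i) (j) (_ : i < j), ({e i + e j, e i - e j, -e i + e j, -e i - e j} : Set V)) ∪
  {v | ∃ s : Fin 4 → ℝ, (∀ i, s i = 1 ∨ s i = -1) ∧ v = (1 / 2 : ℝ) • ∑ i, s i • e i}

def φ₁ : V := e 1 - e 2
def φ₂ : V := e 2 - e 3
def φ₃ : V := e 3
def φ₄ : V := (1 / 2 : ℝ) • (e 0 - e 1 - e 2 - e 3)

def φv : Fin 4 → V := ![φ₁, φ₂, φ₃, φ₄]

/-- The coordinates `n₁(α), …, n₄(α)` of `α` with respect to the basis φ₁,…,φ₄: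
for every `α : V` one has `α = ∑ i, n α i • φv i`. -/
def n (α : V) : Fin 4 → ℝ :=
  ![α 1 + α 0, α 1 + α 2 + 2 * α 0, α 1 + α 2 + α 3 + 3 * α 0, 2 * α 0]

/-- The highest root δ = 2φ₁+3φ₂+4φ₃+2φ₄ = e₁+e₂. -/
def δ : V := e 0 + e 1

/-- Compact roots: roots α with n₁(α) even. -/
def Δk : Set V := {α ∈ Δ | ∃ m : ℤ, n α 0 = 2 * m}

/-- Noncompact roots: roots α with n₁(α) odd. -/
def Δn : Set V := {α ∈ Δ | ∃ m : ℤ, n α 0 = 2 * m + 1}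

/-- Δ⁺: roots with all φ-coefficients nonnegative. -/
def Δp : Set V := {α ∈ Δ | ∀ i, 0 ≤ n α i}

def Δkp : Set V := Δp ∩ Δk
def Δnp : Set V := Δp ∩ Δn

/-- A positive system of Δ: the set of roots on which some root-regular linear
functional is positive. -/
def IsPosSystem (P : Set V) : Prop :=
  ∃ f : V →ₗ[ℝ] ℝ, (∀ α ∈ Δ, f α ≠ 0) ∧ P = {α ∈ Δ | 0 < f α}

/-- `le' γ β` means γ ≤ β, i.e. β − γ is a nonnegative integer combination of φ₁,…,φ₄. -/
def le' (γ β : V) : Prop := ∃ c : Fin 4 → ℕ, β - γ = ∑ i, (c i : ℝ) • φv i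

/-- A base of Δ: a linearly independent subset of Δ such that every root is an
integral combination with coefficients all ≥ 0 or all ≤ 0. -/
def IsBase (B : Finset V) : Prop :=
  ↑B ⊆ Δ ∧ LinearIndependent ℝ (Subtype.val : {x : V // x ∈ B} → V) ∧
  ∀ α ∈ Δ, ∃ c : V → ℤ,
    α = ∑ x ∈ B, (c x : ℝ) • x ∧ ((∀ x ∈ B, 0 ≤ c x) ∨ (∀ x ∈ B, c x ≤ 0))

/-- The positive system determined by a base B: roots whose B-coefficients are all ≥ 0. -/
def posOf (B : Finset V) : Set V :=
  {α ∈ Δ | ∃ c : V → ℤ, α = ∑ x ∈ B, (c x : ℝ) • x ∧ ∀ x ∈ B, 0 ≤ c x}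

/-- The vector with integer coordinates `w` in the basis φ₁,…,φ₄. -/
def ofCoords (w : Fin 4 → ℤ) : V := ∑ i, (w i : ℝ) • φv i

lemma ofCoords_apply (w : Fin 4 → ℤ) :
    ofCoords w = ![(w 3 : ℝ) / 2, w 0 - (w 3 : ℝ) / 2, w 1 - w 0 - (w 3 : ℝ) / 2,
      w 2 - w 1 - (w 3 : ℝ) / 2] := by
  ext k
  fin_cases k <;>
    simp [ofCoords, φv, φ₁, φ₂, φ₃, φ₄, e, Fin.sum_univ_four] <;> ring

lemma ofCoords_neg (w : Fin 4 → ℤ) : ofCoords (-w) = -ofCoords w := by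
  simp [ofCoords]

lemma ofCoords_add (v w : Fin 4 → ℤ) : ofCoords (v + w) = ofCoords v + ofCoords w := by
  simp [ofCoords, add_smul, Finset.sum_add_distrib]

lemma ofCoords_sub (v w : Fin 4 → ℤ) : ofCoords (v - w) = ofCoords v - ofCoords w := by
  rw [sub_eq_add_neg, ofCoords_add, ofCoords_neg, sub_eq_add_neg]

lemma n_ofCoords (w : Fin 4 → ℤ) (i : Fin 4) : n (ofCoords w) i = w i := by
  rw [ofCoords_apply]
  fin_cases i <;> simp [n] <;> ring

lemma ofCoords_injective : Function.Injective ofCoords := by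
  intro v w h
  ext i
  have := congrArg (fun α => n α i) h
  simpa only [n_ofCoords, Int.cast_inj] using this

/-- The squared Euclidean length of `ofCoords w`. -/
def normSqCoords (w : Fin 4 → ℤ) : ℤ :=
  w 0 ^ 2 + (w 1 - w 0) ^ 2 + (w 2 - w 1) ^ 2 + w 3 ^ 2 - w 2 * w 3

/-- A decidable condition satisfied by the φ-coordinates of every root. -/
def IsRootCoords (w : Fin 4 → ℤ) : Prop :=
  (∀ i, w i ∈ Finset.Icc (-4 : ℤ) 4) ∧ (normSqCoords w = 1 ∨ normSqCoords w = 2)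

instance (w : Fin 4 → ℤ) : Decidable (IsRootCoords w) := by
  unfold IsRootCoords; infer_instance

/-- The φ-coordinates of the standard basis vectors. -/
def eCoords : Fin 4 → Fin 4 → ℤ :=
  ![![1, 2, 3, 2], ![1, 1, 1, 0], ![0, 1, 1, 0], ![0, 0, 1, 0]]

lemma ofCoords_eCoords (i : Fin 4) : ofCoords (eCoords i) = e i := by
  rw [ofCoords_apply]
  ext k
  fin_cases i <;> fin_cases k <;> simp [eCoords, e] <;> norm_num

lemma isRootCoords_eCoords : ∀ i, IsRootCoords (eCoords i) ∧ IsRootCoords (-eCoords i) := by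
  decide

lemma isRootCoords_eCoords_pair : ∀ i j, i < j →
    IsRootCoords (eCoords i + eCoords j) ∧ IsRootCoords (eCoords i - eCoords j) ∧
    IsRootCoords (-eCoords i + eCoords j) ∧ IsRootCoords (-eCoords i - eCoords j) := by
  decide

/-- The φ-coordinates of the half-integral root whose sign at `e i` is `2 * t i - 1`. -/
def halfCoords (t : Fin 4 → Fin 2) : Fin 4 → ℤ :=
  let a : Fin 4 → ℤ := fun i => (t i).val
  ![a 0 + a 1 - 1, a 1 + a 2 + 2 * a 0 - 2, a 1 + a 2 + a 3 + 3 * a 0 - 3, 2 * a 0 - 1]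

lemma isRootCoords_halfCoords : ∀ t, IsRootCoords (halfCoords t) := by
  decide +kernel

lemma ofCoords_halfCoords (t : Fin 4 → Fin 2) :
    ofCoords (halfCoords t) =
      (1 / 2 : ℝ) • ∑ i, (2 * ((t i).val : ℝ) - 1) • e i := by
  rw [ofCoords_apply]
  ext k
  fin_cases k <;>
    simp [halfCoords, e, Fin.sum_univ_four] <;> ring

lemma exists_isRootCoords {α : V} (hα : α ∈ Δ) : ∃ w, IsRootCoords w ∧ α = ofCoords w := by
  rcases hα with (h | h) | ⟨s, hs, rfl⟩
  · obtain ⟨i, h⟩ := Set.mem_iUnion.1 h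
    rcases h with rfl | rfl
    · exact ⟨_, (isRootCoords_eCoords i).1, (ofCoords_eCoords i).symm⟩
    · exact ⟨_, (isRootCoords_eCoords i).2, by rw [ofCoords_neg, ofCoords_eCoords]⟩
  · simp only [Set.mem_iUnion] at h
    obtain ⟨i, j, hij, h⟩ := h
    obtain ⟨h₁, h₂, h₃, h₄⟩ := isRootCoords_eCoords_pair i j hij
    rcases h with rfl | rfl | rfl | rfl
    · exact ⟨_, h₁, by simp only [ofCoords_add, ofCoords_eCoords]⟩
    · exact ⟨_, h₂, by simp only [ofCoords_sub, ofCoords_eCoords]⟩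
    · exact ⟨_, h₃, by simp only [ofCoords_add, ofCoords_neg, ofCoords_eCoords]⟩
    · exact ⟨_, h₄, by simp only [ofCoords_sub, ofCoords_neg, ofCoords_eCoords]⟩
  · have ht : ∀ i, ∃ t : Fin 2, s i = 2 * (t.val : ℝ) - 1 := fun i => by
      rcases hs i with h | h
      · exact ⟨1, by rw [h]; norm_num⟩
      · exact ⟨0, by rw [h]; norm_num⟩
    choose t ht using ht
    exact ⟨_, isRootCoords_halfCoords t, by simp only [ofCoords_halfCoords, ht]⟩

lemma neg_mem_Δ {α : V} (hα : α ∈ Δ) : -α ∈ Δ := by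
  rcases hα with (h | h) | ⟨s, hs, rfl⟩
  · obtain ⟨i, h⟩ := Set.mem_iUnion.1 h
    refine .inl (.inl (Set.mem_iUnion.2 ⟨i, ?_⟩))
    rcases h with rfl | rfl <;> simp
  · simp only [Set.mem_iUnion] at h
    obtain ⟨i, j, hij, h⟩ := h
    refine .inl (.inr ?_)
    simp only [Set.mem_iUnion]
    refine ⟨i, j, hij, ?_⟩
    rcases h with rfl | rfl | rfl | rfl <;>
      simp [sub_eq_add_neg, add_comm]
  · refine .inr ⟨-s, fun i => ?_, by simp⟩
    rcases hs i with h | h <;> simp [h]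

/-- The base of the theorem, as a family. -/
def baseVec : Fin 4 → V := ![δ, -(φ₁ + φ₂ + (2 : ℝ) • φ₃ + (2 : ℝ) • φ₄), φ₃, φ₄]

lemma image_baseVec :
    ({δ, -(φ₁ + φ₂ + (2 : ℝ) • φ₃ + (2 : ℝ) • φ₄), φ₃, φ₄} : Finset V) =
      Finset.univ.image baseVec := by
  ext x
  simp [baseVec, Fin.exists_fin_succ, eq_comm]

lemma sum_smul_baseVec (c : Fin 4 → ℝ) :
    ∑ i, c i • baseVec i =
      ![c 0 - c 1 + c 3 / 2, c 0 - c 3 / 2, c 1 - c 3 / 2, c 2 - c 3 / 2] := by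
  ext k
  fin_cases k <;>
    simp [baseVec, δ, φ₁, φ₂, φ₃, φ₄, e, Fin.sum_univ_four] <;> ring

lemma linearIndependent_baseVec : LinearIndependent ℝ baseVec := by
  rw [Fintype.linearIndependent_iff]
  intro c hc
  rw [sum_smul_baseVec] at hc
  have h0 := congrFun hc 0
  have h1 := congrFun hc 1
  have h2 := congrFun hc 2
  have h3 := congrFun hc 3
  simp at h0 h1 h2 h3
  intro i
  fin_cases i <;> simp <;> linarith

lemma baseVec_mem_Δ (i : Fin 4) : baseVec i ∈ Δ := by
  fin_cases i
  · refine .inl (.inr ?_)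
    simp only [Set.mem_iUnion]
    exact ⟨0, 1, by decide, .inl rfl⟩
  · refine .inl (.inr ?_)
    simp only [Set.mem_iUnion]
    refine ⟨0, 2, by decide, .inr (.inr (.inl ?_))⟩
    simp only [baseVec, φ₁, φ₂, φ₃, φ₄]
    simp
    module
  · exact .inl (.inl (Set.mem_iUnion.2 ⟨3, .inl rfl⟩))
  · refine .inr ⟨![1, -1, -1, -1], fun i => by fin_cases i <;> simp, ?_⟩
    simp [baseVec, φ₄, Fin.sum_univ_four, sub_eq_add_neg]

/-- The coordinates with respect to `baseVec` of the vector with φ-coordinates `w`. -/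
def baseCoords (w : Fin 4 → ℤ) : Fin 4 → ℤ :=
  ![w 1 - w 0, 2 * w 1 - 3 * w 0, w 2 - 2 * w 0, w 3 + 2 * w 1 - 4 * w 0]

lemma ofCoords_eq_sum_baseCoords (w : Fin 4 → ℤ) :
    ofCoords w = ∑ i, (baseCoords w i : ℝ) • baseVec i := by
  rw [sum_smul_baseVec, ofCoords_apply]
  ext k
  fin_cases k <;> simp [baseCoords] <;> ring

lemma ofCoords_eq_sum_iff (w c : Fin 4 → ℤ) :
    ofCoords w = ∑ i, (c i : ℝ) • baseVec i ↔ c = baseCoords w := by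
  refine ⟨fun h => ?_, fun h => h ▸ ofCoords_eq_sum_baseCoords w⟩
  rw [ofCoords_eq_sum_baseCoords] at h
  ext i
  have := (Fintype.linearIndependent_iffₛ.1 linearIndependent_baseVec) _ _ h i
  exact_mod_cast this.symm

lemma exists_coeff_iff (P : ℤ → Prop) (w : Fin 4 → ℤ) :
    (∃ c : V → ℤ, ofCoords w = ∑ x ∈ Finset.univ.image baseVec, (c x : ℝ) • x ∧
      ∀ x ∈ Finset.univ.image baseVec, P (c x)) ↔ ∀ i, P (baseCoords w i) := by
  have hinj := linearIndependent_baseVec.injective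
  simp only [Finset.sum_image hinj.injOn, Finset.mem_image, Finset.mem_univ, true_and,
    forall_exists_index, forall_apply_eq_imp_iff]
  constructor
  · rintro ⟨c, hc, hP⟩ i
    rw [ofCoords_eq_sum_iff w (fun i => c (baseVec i))] at hc
    rw [← hc]
    exact hP i
  · intro h
    refine ⟨Function.extend baseVec (baseCoords w) 0, ?_, fun i => ?_⟩
    · simpa only [hinj.extend_apply] using ofCoords_eq_sum_baseCoords w
    · rw [hinj.extend_apply]; exact h i

lemma le'_ofCoords (v w : Fin 4 → ℤ) : le' (ofCoords v) (ofCoords w) ↔ ∀ i, v i ≤ w i := by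
  constructor
  · rintro ⟨c, hc⟩ i
    have : ofCoords (w - v) = ofCoords (fun i => (c i : ℤ)) := by
      rw [ofCoords_sub, hc]
      simp [ofCoords]
    have := congrFun (ofCoords_injective this) i
    simp only [Pi.sub_apply] at this
    lia
  · intro h
    refine ⟨fun i => (w i - v i).toNat, ?_⟩
    rw [← ofCoords_sub, ofCoords]
    refine Finset.sum_congr rfl fun i _ => ?_
    congr 1
    have := Int.toNat_of_nonneg (sub_nonneg.2 (h i))
    rw [Pi.sub_apply]
    exact_mod_cast this.symm

lemma lower_eq_ofCoords : φ₁ + (2 : ℝ) • φ₂ + (2 : ℝ) • φ₃ = ofCoords ![1, 2, 2, 0] := by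
  simp [ofCoords, φv, Fin.sum_univ_four]

lemma upper_eq_ofCoords :
    φ₁ + φ₂ + (2 : ℝ) • φ₃ + (2 : ℝ) • φ₄ = ofCoords ![1, 1, 2, 2] := by
  simp [ofCoords, φv, Fin.sum_univ_four]

lemma ofCoords_mem_Δkp_iff {w : Fin 4 → ℤ} (h : ofCoords w ∈ Δ) :
    ofCoords w ∈ Δkp ↔ (∀ i, 0 ≤ w i) ∧ w 0 % 2 = 0 := by
  have hpar : (∃ m : ℤ, (w 0 : ℝ) = 2 * m) ↔ w 0 % 2 = 0 := by
    norm_cast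
    exact ⟨fun ⟨m, hm⟩ => by lia, fun h => ⟨w 0 / 2, by lia⟩⟩
  simp only [Δkp, Δp, Δk, Set.mem_inter_iff, Set.mem_ofPred_eq, h, true_and, n_ofCoords,
    Int.cast_nonneg_iff, hpar]

lemma ofCoords_mem_Δnp_iff {w : Fin 4 → ℤ} (h : ofCoords w ∈ Δ) :
    ofCoords w ∈ Δnp ↔ (∀ i, 0 ≤ w i) ∧ w 0 % 2 = 1 := by
  have hpar : (∃ m : ℤ, (w 0 : ℝ) = 2 * m + 1) ↔ w 0 % 2 = 1 := by
    norm_cast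
    exact ⟨fun ⟨m, hm⟩ => by lia, fun h => ⟨w 0 / 2, by lia⟩⟩
  simp only [Δnp, Δp, Δn, Set.mem_inter_iff, Set.mem_ofPred_eq, h, true_and, n_ofCoords,
    Int.cast_nonneg_iff, hpar]

lemma forall_isRootCoords {P : (Fin 4 → ℤ) → Prop}
    (h : ∀ a ∈ Finset.Icc (-4 : ℤ) 4, ∀ b ∈ Finset.Icc (-4 : ℤ) 4, ∀ c ∈ Finset.Icc (-4 : ℤ) 4,
      ∀ d ∈ Finset.Icc (-4 : ℤ) 4,
      (normSqCoords ![a, b, c, d] = 1 ∨ normSqCoords ![a, b, c, d] = 2) → P ![a, b, c, d])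
    {w : Fin 4 → ℤ} (hw : IsRootCoords w) : P w := by
  have hw' : w = ![w 0, w 1, w 2, w 3] := by
    ext i; fin_cases i <;> rfl
  rw [hw']
  exact h _ (hw.1 0) _ (hw.1 1) _ (hw.1 2) _ (hw.1 3) (hw' ▸ hw.2)

lemma baseCoords_nonneg_or_nonpos {w : Fin 4 → ℤ} (hw : IsRootCoords w) :
    (∀ i, 0 ≤ baseCoords w i) ∨ ∀ i, baseCoords w i ≤ 0 :=
  forall_isRootCoords (P := fun w => (∀ i, 0 ≤ baseCoords w i) ∨ ∀ i, baseCoords w i ≤ 0)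
    (by decide +kernel) hw

lemma baseCoords_nonneg_iff {w : Fin 4 → ℤ} (hw : IsRootCoords w) :
    (∀ i, 0 ≤ baseCoords w i) ↔
      (((∀ i, 0 ≤ w i) ∧ w 0 % 2 = 0) ∨
        (((∀ i, 0 ≤ w i) ∧ w 0 % 2 = 1) ∧ ∀ i, ![1, 2, 2, 0] i ≤ w i)) ∨
        (((∀ i, 0 ≤ (-w) i) ∧ (-w) 0 % 2 = 1) ∧ ∀ i, (-w) i ≤ ![1, 1, 2, 2] i) :=
  forall_isRootCoords (P := fun w => (∀ i, 0 ≤ baseCoords w i) ↔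
      (((∀ i, 0 ≤ w i) ∧ w 0 % 2 = 0) ∨
        (((∀ i, 0 ≤ w i) ∧ w 0 % 2 = 1) ∧ ∀ i, ![1, 2, 2, 0] i ≤ w i)) ∨
        (((∀ i, 0 ≤ (-w) i) ∧ (-w) 0 % 2 = 1) ∧ ∀ i, (-w) i ≤ ![1, 1, 2, 2] i))
    (by decide +kernel) hw

lemma isBase_image_baseVec : IsBase (Finset.univ.image baseVec) := by
  refine ⟨?_, ?_, fun α hα => ?_⟩
  · intro x hx
    obtain ⟨i, -, rfl⟩ := Finset.mem_image.1 hx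
    exact baseVec_mem_Δ i
  · have h := linearIndependent_baseVec.linearIndepOn_id
    rw [← Set.image_univ, ← Finset.coe_univ, ← Finset.coe_image] at h
    exact h
  · obtain ⟨w, hw, rfl⟩ := exists_isRootCoords hα
    rcases baseCoords_nonneg_or_nonpos hw with h | h
    · obtain ⟨c, hc, hP⟩ := (exists_coeff_iff (0 ≤ ·) w).2 h
      exact ⟨c, hc, .inl hP⟩
    · obtain ⟨c, hc, hP⟩ := (exists_coeff_iff (· ≤ 0) w).2 h
      exact ⟨c, hc, .inr hP⟩

lemma posOf_image_baseVec :
    posOf (Finset.univ.image baseVec) =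
      Δkp ∪ {β ∈ Δnp | le' (φ₁ + (2 : ℝ) • φ₂ + (2 : ℝ) • φ₃) β} ∪
        (Neg.neg '' {β ∈ Δnp | le' β (φ₁ + φ₂ + (2 : ℝ) • φ₃ + (2 : ℝ) • φ₄)}) := by
  have hsub : Δkp ∪ {β ∈ Δnp | le' (φ₁ + (2 : ℝ) • φ₂ + (2 : ℝ) • φ₃) β} ∪
      (Neg.neg '' {β ∈ Δnp | le' β (φ₁ + φ₂ + (2 : ℝ) • φ₃ + (2 : ℝ) • φ₄)}) ⊆ Δ := by
    rintro α ((h | h) | ⟨β, h, rfl⟩)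
    · exact h.1.1
    · exact h.1.1.1
    · exact neg_mem_Δ h.1.1.1
  rw [← Set.inter_eq_right.2 hsub]
  ext α
  refine and_congr_right fun hα => ?_
  obtain ⟨w, hw, rfl⟩ := exists_isRootCoords hα
  have hneg : ofCoords (-w) ∈ Δ := ofCoords_neg w ▸ neg_mem_Δ hα
  rw [exists_coeff_iff (0 ≤ ·) w, baseCoords_nonneg_iff hw, lower_eq_ofCoords, upper_eq_ofCoords,
    Set.image_neg_eq_neg]
  simp only [Set.mem_union, Set.mem_ofPred_eq, Set.mem_neg, ← ofCoords_neg, le'_ofCoords,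
    ofCoords_mem_Δkp_iff hα, ofCoords_mem_Δnp_iff hα, ofCoords_mem_Δnp_iff hneg]

theorem stmt15 :
    IsBase ({δ, -(φ₁ + φ₂ + (2 : ℝ) • φ₃ + (2 : ℝ) • φ₄), φ₃, φ₄} : Finset V) ∧
    posOf ({δ, -(φ₁ + φ₂ + (2 : ℝ) • φ₃ + (2 : ℝ) • φ₄), φ₃, φ₄} : Finset V) =
      Δkp ∪ {β ∈ Δnp | le' (φ₁ + (2 : ℝ) • φ₂ + (2 : ℝ) • φ₃) β} ∪ (Neg.neg '' {β ∈ Δnp | le' β (φ₁ + φ₂ + (2 : ℝ) • φ₃ + (2 : ℝ) • φ₄)}) ∧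
    Δkp ⊆ posOf ({δ, -(φ₁ + φ₂ + (2 : ℝ) • φ₃ + (2 : ℝ) • φ₄), φ₃, φ₄} : Finset V) := by
  rw [image_baseVec, posOf_image_baseVec]
  exact ⟨isBase_image_baseVec, rfl, fun _ h => .inl (.inl h)⟩
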